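/- Let S be a finite nonempty set, p : S → S → ℝ a stochastic matrix with all entries strictly positive, g : S → ℝ, and ζ ∈ ℝ. If (ρ₁, V₁) and (ρ₂, V₂) both satisfy the multiplicative Poisson equation with ρ₁, ρ₂ > 0 and V₁, V₂ strictly positive, then ρ₁ = ρ₂ and there exists a constant c > 0 with V₁(i) = c·V₂(i) for all i ∈ S. -/

import Mathlib

/-- One-sided comparison at a minimizer of the ratio `V₁ / V₂`. -/
theorem mp_aux {S : Type*} [Fintype S] [Nonempty S]
    (p : S → S → ℝ) (hp_pos : ∀ i j, 0 < p i j) (k : S → ℝ) (hk : ∀ i, 0 < k i)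
    (ρ₁ ρ₂ : ℝ) (V₁ V₂ : S → ℝ)
    (hρ₁ : 0 < ρ₁) (hρ₂ : 0 < ρ₂)
    (hV₁ : ∀ i, 0 < V₁ i) (hV₂ : ∀ i, 0 < V₂ i)
    (heq₁ : ∀ i, V₁ i = (k i / ρ₁) * ∑ j, p i j * V₁ j)
    (heq₂ : ∀ i, V₂ i = (k i / ρ₂) * ∑ j, p i j * V₂ j) :
    ρ₂ ≤ ρ₁ ∧ (ρ₁ = ρ₂ → ∃ c : ℝ, 0 < c ∧ ∀ i, V₁ i = c * V₂ i) := by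
  obtain ⟨m, hm⟩ := Finite.exists_min (fun i => V₁ i / V₂ i)
  obtain ⟨c, hc⟩ : ∃ c, c = V₁ m / V₂ m := ⟨_, rfl⟩
  have hc0 : 0 < c := hc ▸ div_pos (hV₁ m) (hV₂ m)
  have hcm : V₁ m = c * V₂ m := by
    rw [hc, div_mul_cancel₀ _ (hV₂ m).ne']
  have hle : ∀ j, 0 ≤ V₁ j - c * V₂ j := by
    intro j
    have h := hm j
    simp only [← hc] at h
    rw [le_div_iff₀ (hV₂ j)] at h
    linarith
  have h1 : ρ₁ * V₁ m = k m * ∑ j, p m j * V₁ j := by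
    conv_lhs => rw [heq₁ m]
    field_simp
  have h2 : ρ₂ * V₂ m = k m * ∑ j, p m j * V₂ j := by
    conv_lhs => rw [heq₂ m]
    field_simp
  have hsum : ∑ j, p m j * (V₁ j - c * V₂ j)
      = ∑ j, p m j * V₁ j - c * ∑ j, p m j * V₂ j := by
    rw [Finset.mul_sum, ← Finset.sum_sub_distrib]
    exact Finset.sum_congr rfl fun j _ => by ring
  have hnn : ∀ j ∈ Finset.univ, 0 ≤ p m j * (V₁ j - c * V₂ j) :=
    fun j _ => mul_nonneg (hp_pos m j).le (hle j)
  have key : (ρ₁ - ρ₂) * V₁ m = k m * ∑ j, p m j * (V₁ j - c * V₂ j) := by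
    rw [hsum]
    linear_combination h1 - c * h2 - ρ₂ * hcm
  constructor
  · have h : 0 ≤ (ρ₁ - ρ₂) * V₁ m := key ▸ mul_nonneg (hk m).le (Finset.sum_nonneg hnn)
    linarith [nonneg_of_mul_nonneg_left h (hV₁ m)]
  · intro he
    refine ⟨c, hc0, fun i => ?_⟩
    rw [he, sub_self, zero_mul] at key
    have h0 := (mul_eq_zero.mp key.symm).resolve_left (hk m).ne'
    have hi := (Finset.sum_eq_zero_iff_of_nonneg hnn).mp h0 i (Finset.mem_univ i)
    linarith [(mul_eq_zero.mp hi).resolve_left (hp_pos m i).ne']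

/-- Uniqueness of the solution to the multiplicative Poisson equation:
the eigenvalue `ρ` is unique and the positive eigenfunction `V` is unique up
to a positive scalar multiple. -/
theorem multiplicative_poisson_unique
    {S : Type*} [Fintype S] [Nonempty S]
    (p : S → S → ℝ)
    (hp_pos : ∀ i j, 0 < p i j)
    (hp_row : ∀ i, ∑ j, p i j = 1)
    (g : S → ℝ) (ζ : ℝ)
    (ρ₁ ρ₂ : ℝ) (V₁ V₂ : S → ℝ)
    (hρ₁ : 0 < ρ₁) (hρ₂ : 0 < ρ₂)
    (hV₁ : ∀ i, 0 < V₁ i) (hV₂ : ∀ i, 0 < V₂ i)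
    (heq₁ : ∀ i, V₁ i = (Real.exp (ζ * g i) / ρ₁) * ∑ j, p i j * V₁ j)
    (heq₂ : ∀ i, V₂ i = (Real.exp (ζ * g i) / ρ₂) * ∑ j, p i j * V₂ j) :
    ρ₁ = ρ₂ ∧ ∃ c : ℝ, 0 < c ∧ ∀ i, V₁ i = c * V₂ i := by
  have hk : ∀ i, 0 < Real.exp (ζ * g i) := fun i => Real.exp_pos _
  have A := mp_aux p hp_pos _ hk ρ₁ ρ₂ V₁ V₂ hρ₁ hρ₂ hV₁ hV₂ heq₁ heq₂
  have B := mp_aux p hp_pos _ hk ρ₂ ρ₁ V₂ V₁ hρ₂ hρ₁ hV₂ hV₁ heq₂ heq₁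
  have h := le_antisymm B.1 A.1
  exact ⟨h, A.2 h⟩
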